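/- Let n ≥ 2 and let A(2n) = ⟨x, y ‖ (xy)ⁿ = (yx)ⁿ⟩ be the 2-generated Artin group. Then the center of A(2n) is the infinite cyclic subgroup generated by the element (xy)ⁿ. -/

import Mathlib

/-- The defining relation of the 2-generated Artin group `A(2n) = ⟨x, y ‖ (xy)ⁿ = (yx)ⁿ⟩`. -/
def artinEvenRels (n : ℕ) : Set (FreeGroup (Fin 2)) :=
  {(FreeGroup.of 0 * FreeGroup.of 1) ^ n * ((FreeGroup.of 1 * FreeGroup.of 0) ^ n)⁻¹}

/-- The 2-generated Artin group `A(2n)`. -/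
abbrev ArtinEven (n : ℕ) := PresentedGroup (artinEvenRels n)

open Monoid in
/-- Reduced lists of letters representing the same element of a free product are equal. -/
theorem CoprodI.list_eq_of_prod_eq {ι : Type*} {G : ι → Type*} [∀ i, Group (G i)]
    {l₁ l₂ : List (Σ i, G i)}
    (h₁ : ∀ s ∈ l₁, s.2 ≠ 1) (c₁ : l₁.IsChain fun s t => s.1 ≠ t.1)
    (h₂ : ∀ s ∈ l₂, s.2 ≠ 1) (c₂ : l₂.IsChain fun s t => s.1 ≠ t.1)
    (h : (l₁.map fun s => (CoprodI.of s.2 : CoprodI G)).prod =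
      (l₂.map fun s => (CoprodI.of s.2 : CoprodI G)).prod) : l₁ = l₂ := by
  classical
  exact congrArg CoprodI.Word.toList
    (CoprodI.Word.equiv.symm.injective (a₁ := ⟨l₁, h₁, c₁⟩) (a₂ := ⟨l₂, h₂, c₂⟩) h)

open Monoid in
/-- A free product of at least two nontrivial groups is centerless. -/
theorem CoprodI.center_eq_bot {ι : Type*} [Nontrivial ι] {G : ι → Type*} [∀ i, Group (G i)]
    [∀ i, Nontrivial (G i)] : Subgroup.center (CoprodI G) = ⊥ := by
  classical
  rw [eq_bot_iff]
  intro g hg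
  rw [Subgroup.mem_center_iff] at hg
  obtain ⟨⟨l, hl, cl⟩, rfl⟩ := CoprodI.Word.equiv.symm.surjective g
  change ∀ g, g * (l.map fun s => (CoprodI.of s.2 : CoprodI G)).prod =
    (l.map fun s => (CoprodI.of s.2 : CoprodI G)).prod * g at hg
  change (l.map fun s => (CoprodI.of s.2 : CoprodI G)).prod = 1
  rcases l with _ | ⟨⟨i, m⟩, l⟩
  · simp
  exfalso
  by_cases hlast : ∀ s ∈ (⟨i, m⟩ :: l : List (Σ i, G i)).getLast?, s.1 = i
  · obtain ⟨k, hk⟩ := exists_ne i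
    obtain ⟨h, h_ne⟩ := exists_ne (1 : G k)
    have key := CoprodI.list_eq_of_prod_eq
      (l₁ := ⟨k, h⟩ :: ((⟨i, m⟩ :: l) ++ [⟨k, h⁻¹⟩])) (l₂ := ⟨i, m⟩ :: l) ?_ ?_ hl cl ?_
    · have := congrArg List.length key
      simp only [List.length_cons, List.length_append] at this
      omega
    · intro s hs
      rw [List.mem_cons, List.mem_append, List.mem_singleton] at hs
      rcases hs with rfl | hs | rfl
      · exact h_ne
      · exact hl s hs
      · simpa using h_ne
    · rw [List.cons_append, List.isChain_cons_cons, ← List.cons_append, List.isChain_append]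
      refine ⟨hk, cl, by simp, ?_⟩
      rintro s hs t ht
      simp only [List.head?_cons, Option.mem_some_iff] at ht
      subst ht
      rw [hlast s hs]
      exact hk.symm
    · have := hg (CoprodI.of h)
      rw [List.map_cons, List.prod_cons, List.map_append, List.prod_append, ← mul_assoc]
      dsimp only
      rw [this]
      simp
  · have hne : l ≠ [] := by
      rintro rfl
      simp at hlast
    have key := CoprodI.list_eq_of_prod_eq (l₁ := l ++ [⟨i, m⟩]) (l₂ := ⟨i, m⟩ :: l) ?_ ?_ hl cl ?_
    · rcases l with _ | ⟨s, l⟩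
      · exact hne rfl
      · rw [List.cons_append, List.cons.injEq] at key
        rw [List.isChain_cons_cons] at cl
        exact cl.1 (by rw [key.1])
    · intro s hs
      rw [List.mem_append, List.mem_singleton] at hs
      exact hl s (by rw [List.mem_cons]; exact hs.symm)
    · rw [List.isChain_append]
      refine ⟨cl.tail, by simp, ?_⟩
      rintro s hs t ht
      simp only [List.head?_cons, Option.mem_some_iff] at ht
      subst ht
      intro hsi
      apply hlast
      rcases l with _ | ⟨s', l⟩
      · exact absurd rfl hne
      · rw [List.getLast?_cons_cons]
        intro u hu
        rwa [Option.mem_unique hu hs]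
    · have := hg (CoprodI.of m)
      simp only [List.map_cons, List.prod_cons, List.map_append, List.prod_append, List.map_nil,
        List.prod_nil, mul_one] at this ⊢
      rw [mul_assoc] at this
      exact (mul_left_cancel this).symm

/-- An element with `g ^ m = 1` is the image of the generator of the cyclic group of order `m`. -/
theorem exists_monoidHom_zmod_of_pow_eq_one {Q : Type*} [Group Q] {m : ℕ} {g : Q}
    (hg : g ^ m = 1) :
    ∃ f : Multiplicative (ZMod m) →* Q, f (Multiplicative.ofAdd 1) = g := by
  let F : ℤ →+ Additive Q := zmultiplesHom _ (Additive.ofMul g)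
  have hF : F m = 0 := by
    simp only [F, zmultiplesHom_apply, natCast_zsmul, ← ofMul_pow, hg, ofMul_one]
  refine ⟨AddMonoidHom.toMultiplicativeLeft (ZMod.lift m ⟨F, hF⟩), ?_⟩
  have := ZMod.lift_coe m ⟨F, hF⟩ 1
  simp only [Int.cast_one, F, zmultiplesHom_apply, one_zsmul] at this
  simp [this, F]

/-- The orders (`0` meaning infinite) of the two cyclic free factors of the central quotient of
`A(2n)`. -/
def artinFactorOrder (n : ℕ) (b : Bool) : ℕ := if b then n else 0

/-- The free product `ℤ ∗ ℤ/n`. -/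
abbrev ArtinCentralQuotient (n : ℕ) :=
  Monoid.CoprodI fun b => Multiplicative (ZMod (artinFactorOrder n b))

namespace ArtinEven

variable {n : ℕ}

/-- The canonical generator of a free factor of `ℤ ∗ ℤ/n`. -/
def factorGen (n : ℕ) (b : Bool) : ArtinCentralQuotient n :=
  Monoid.CoprodI.of (i := b) (Multiplicative.ofAdd 1)

theorem factorGen_true_pow : factorGen n true ^ n = 1 := by
  rw [factorGen, ← map_pow, ← ofAdd_nsmul, nsmul_one,
    show ((n : ZMod (artinFactorOrder n true))) = 0 from ZMod.natCast_self n, ofAdd_zero, map_one]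

theorem range_eq_top {A : Type*} [Group A] {f : A →* ArtinCentralQuotient n}
    (hf : ∀ b, factorGen n b ∈ f.range) : f.range = ⊤ := by
  rw [eq_top_iff]
  rintro g -
  induction g using Monoid.CoprodI.induction_on with
  | one => exact one_mem _
  | of b k =>
    obtain ⟨k, rfl⟩ := Multiplicative.ofAdd.surjective k
    obtain ⟨k, rfl⟩ := ZMod.intCast_surjective k
    have : (Monoid.CoprodI.of (i := b) (Multiplicative.ofAdd
        (k : ZMod (artinFactorOrder n b))) : ArtinCentralQuotient n) = factorGen n b ^ k := by
      rw [factorGen, ← map_zpow, ← ofAdd_zsmul, zsmul_one]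
    rw [this]
    exact zpow_mem (hf b) k
  | mul x y hx hy => exact mul_mem hx hy

theorem center_centralQuotient (hn : 2 ≤ n) : Subgroup.center (ArtinCentralQuotient n) = ⊥ := by
  have (b : Bool) : Nontrivial (ZMod (artinFactorOrder n b)) := by
    rw [ZMod.nontrivial_iff]
    cases b <;> simp [artinFactorOrder]
    omega
  exact CoprodI.center_eq_bot

theorem relation : (PresentedGroup.of 0 * PresentedGroup.of 1 : ArtinEven n) ^ n =
    (PresentedGroup.of 1 * PresentedGroup.of 0) ^ n :=
  PresentedGroup.mk_eq_mk_of_mul_inv_mem rfl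

theorem pow_mem_center : (PresentedGroup.of 0 * PresentedGroup.of 1 : ArtinEven n) ^ n ∈
    Subgroup.center (ArtinEven n) := by
  set x : ArtinEven n := PresentedGroup.of 0
  set y : ArtinEven n := PresentedGroup.of 1
  have rel : (x * y) ^ n = (y * x) ^ n := relation
  have comm_x : x * (x * y) ^ n = (x * y) ^ n * x := by
    nth_rw 1 [rel]
    exact ((SemiconjBy.pow_right (by simp [SemiconjBy, mul_assoc]) n :
      SemiconjBy x ((y * x) ^ n) ((x * y) ^ n))).eq
  have comm_y : y * (x * y) ^ n = (x * y) ^ n * y := by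
    nth_rw 2 [rel]
    exact ((SemiconjBy.pow_right (by simp [SemiconjBy, mul_assoc]) n :
      SemiconjBy y ((x * y) ^ n) ((y * x) ^ n))).eq
  have h := PresentedGroup.generated_by (artinEvenRels n)
    (Subgroup.centralizer {(x * y) ^ n}) (by
      intro j
      rw [Subgroup.mem_centralizer_singleton_iff]
      fin_cases j
      · exact comm_x
      · exact comm_y)
  rw [Subgroup.mem_center_iff]
  exact fun g => Subgroup.mem_centralizer_singleton_iff.mp (h g)

/-- The quotient map from `A(2n)` to `ℤ ∗ ℤ/n`, sending `x` and `xy` to the canonical generators. -/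
def toCentralQuotient (n : ℕ) : ArtinEven n →* ArtinCentralQuotient n :=
  PresentedGroup.toGroup
    (f := ![factorGen n false, (factorGen n false)⁻¹ * factorGen n true]) (by
      rintro _ rfl
      have h : ((factorGen n false)⁻¹ * factorGen n true * factorGen n false) ^ n = 1 := by
        simpa [factorGen_true_pow] using
          conj_pow (a := (factorGen n false)⁻¹) (b := factorGen n true) (i := n)
      simp [factorGen_true_pow, h])

theorem toCentralQuotient_zero :
    toCentralQuotient n (PresentedGroup.of 0) = factorGen n false :=
  PresentedGroup.toGroup.of _

theorem toCentralQuotient_one :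
    toCentralQuotient n (PresentedGroup.of 1) = (factorGen n false)⁻¹ * factorGen n true :=
  PresentedGroup.toGroup.of _

theorem toCentralQuotient_surjective : Function.Surjective (toCentralQuotient n) := by
  refine MonoidHom.range_eq_top.mp (range_eq_top ?_)
  rintro (_ | _)
  · exact ⟨_, toCentralQuotient_zero⟩
  · refine ⟨PresentedGroup.of 0 * PresentedGroup.of 1, ?_⟩
    rw [map_mul, toCentralQuotient_zero, toCentralQuotient_one, mul_inv_cancel_left]

theorem ker_toCentralQuotient_le : (toCentralQuotient n).ker ≤
    Subgroup.zpowers ((PresentedGroup.of 0 * PresentedGroup.of 1 : ArtinEven n) ^ n) := by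
  set z := (PresentedGroup.of 0 * PresentedGroup.of 1 : ArtinEven n) ^ n
  have : (Subgroup.zpowers z).Normal := by
    have hle : Subgroup.zpowers z ≤ Subgroup.center (ArtinEven n) :=
      (Subgroup.zpowers_le).mpr pow_mem_center
    refine ⟨fun a ha g => ?_⟩
    rwa [Subgroup.mem_center_iff.mp (hle ha) g, mul_inv_cancel_right]
  let π := QuotientGroup.mk' (Subgroup.zpowers z)
  have hπ : π (PresentedGroup.of 0 * PresentedGroup.of 1) ^ n = 1 := by
    rw [← map_pow]
    exact (QuotientGroup.eq_one_iff z).mpr (Subgroup.mem_zpowers z)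
  have key (b : Bool) : ∃ f : Multiplicative (ZMod (artinFactorOrder n b)) →* _ ,
      f (Multiplicative.ofAdd 1) =
        π (if b then PresentedGroup.of 0 * PresentedGroup.of 1 else PresentedGroup.of 0) :=
    exists_monoidHom_zmod_of_pow_eq_one (by
      cases b
      · exact pow_zero _
      · exact hπ)
  choose f hf using key
  have hgen (b : Bool) : Monoid.CoprodI.lift f (factorGen n b) =
      π (if b then PresentedGroup.of 0 * PresentedGroup.of 1 else PresentedGroup.of 0) := by
    rw [factorGen, Monoid.CoprodI.lift_of, hf]
  have hcomp : (Monoid.CoprodI.lift f).comp (toCentralQuotient n) = π := by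
    refine PresentedGroup.ext fun j => ?_
    fin_cases j
    · simpa [toCentralQuotient_zero] using hgen false
    · simp [toCentralQuotient_one, hgen]
  intro g hg
  rw [MonoidHom.mem_ker] at hg
  have : π g = 1 := by rw [← hcomp, MonoidHom.comp_apply, hg, map_one]
  exact (QuotientGroup.eq_one_iff g).mp this

theorem not_isOfFinOrder_pow (hn : n ≠ 0) :
    ¬IsOfFinOrder ((PresentedGroup.of 0 * PresentedGroup.of 1 : ArtinEven n) ^ n) := by
  let f : ArtinEven n →* Multiplicative ℤ :=
    PresentedGroup.toGroup (f := fun _ => Multiplicative.ofAdd 1) (by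
      rintro _ rfl
      simp)
  have hf (j : Fin 2) : f (PresentedGroup.of j) = Multiplicative.ofAdd 1 :=
    PresentedGroup.toGroup.of _
  intro h
  obtain ⟨k, hk, h⟩ := isOfFinOrder_iff_pow_eq_one.mp h
  have h := congrArg (fun g => Multiplicative.toAdd (f g)) h
  simp only [map_pow, map_mul, hf, toAdd_pow, toAdd_mul, toAdd_ofAdd, map_one, toAdd_one] at h
  simp at h
  omega

end ArtinEven

/-- For `n ≥ 2`, the center of the Artin group `A(2n) = ⟨x, y ‖ (xy)ⁿ = (yx)ⁿ⟩` is the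
infinite cyclic subgroup generated by `(xy)ⁿ`. -/
theorem artin_even_center (n : ℕ) (hn : 2 ≤ n) :
    Subgroup.center (ArtinEven n) =
      Subgroup.zpowers
        ((PresentedGroup.of 0 * PresentedGroup.of 1 : ArtinEven n) ^ n) ∧
    ¬IsOfFinOrder ((PresentedGroup.of 0 * PresentedGroup.of 1 : ArtinEven n) ^ n) := by
  refine ⟨le_antisymm ?_ ?_, ArtinEven.not_isOfFinOrder_pow (by omega)⟩
  · refine le_trans (fun g hg => ?_) ArtinEven.ker_toCentralQuotient_le
    rw [MonoidHom.mem_ker, ← Subgroup.mem_bot, ← ArtinEven.center_centralQuotient hn,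
      Subgroup.mem_center_iff]
    intro h
    obtain ⟨h, rfl⟩ := ArtinEven.toCentralQuotient_surjective h
    rw [← map_mul, Subgroup.mem_center_iff.mp hg h, map_mul]
  · rw [Subgroup.zpowers_le]
    exact ArtinEven.pow_mem_center
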